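/- Let m, n ∈ ℕ, α, β > 0, σ > 1, p > 1, 1/p + 1/q = 1. Define Φ(x) = ‖x‖_α^{p(m−σ)−m} and Ψ(y) = ‖y‖_β^{q(n+σ)−n}, and let T : L_{p,Φ}(ℝ₊^m) → L_{p,Ψ^{1−p}}(ℝ₊^n) be the operator (Tf)(y) = ∫_{ℝ₊^m} (coth(‖x‖_α/‖y‖_β) − 1) f(x) dx. Then T is a bounded operator and its operator norm equals ‖T‖ = [Γ(1/β)^n/(β^{n−1}Γ(n/β))]^{1/p}[Γ(1/α)^m/(α^{m−1}Γ(m/α))]^{1/q} · (Γ(σ)/2^{σ−1}) ζ(σ). -/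

import Mathlib

open MeasureTheory Real Set

noncomputable def cothR (v : ℝ) : ℝ := (Real.exp v + Real.exp (-v)) / (Real.exp v - Real.exp (-v))
noncomputable def zetaR (σ : ℝ) : ℝ := ∑' k : ℕ+, (k : ℝ) ^ (-σ)
noncomputable def pnorm {s : ℕ} (γ : ℝ) (x : Fin s → ℝ) : ℝ := (∑ i, |x i| ^ γ) ^ (1 / γ)

/-- the weighted `L_{p,Φ}` norm on the positive orthant, with weight `w`. -/
noncomputable def wnorm {s : ℕ} (p : ℝ) (w : (Fin s → ℝ) → ℝ) (f : (Fin s → ℝ) → ℝ) : ℝ :=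
  (∫ x in {x : Fin s → ℝ | ∀ i, 0 < x i}, w x * |f x| ^ p) ^ (1 / p)

open scoped ENNReal Pointwise

/-- The open positive orthant. -/
def orthant (s : ℕ) : Set (Fin s → ℝ) := {x | ∀ i, 0 < x i}

lemma orthant_eq_pi (s : ℕ) : orthant s = Set.pi univ (fun _ => Ioi (0 : ℝ)) := by
  ext x; simp [orthant]

lemma measurableSet_orthant (s : ℕ) : MeasurableSet (orthant s) := by
  rw [orthant_eq_pi]
  exact MeasurableSet.univ_pi fun _ => measurableSet_Ioi

lemma measurable_pnorm {s : ℕ} (γ : ℝ) : Measurable (pnorm γ : (Fin s → ℝ) → ℝ) := by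
  unfold pnorm
  fun_prop

lemma pnorm_pos {s : ℕ} (hs : 0 < s) (γ : ℝ) {x : Fin s → ℝ} (hx : x ∈ orthant s) :
    0 < pnorm γ x := by
  have : Nonempty (Fin s) := ⟨⟨0, hs⟩⟩
  exact rpow_pos_of_pos (Finset.sum_pos (fun i _ => rpow_pos_of_pos (abs_pos.2 (hx i).ne') _)
    Finset.univ_nonempty) _

lemma pnorm_smul {s : ℕ} {γ : ℝ} (hγ : 0 < γ) {c : ℝ} (hc : 0 ≤ c) (x : Fin s → ℝ) :
    pnorm γ (c • x) = c * pnorm γ x := by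
  have h : ∑ i, |(c • x) i| ^ γ = c ^ γ * ∑ i, |x i| ^ γ := by
    rw [Finset.mul_sum]
    refine Finset.sum_congr rfl fun i _ => ?_
    rw [Pi.smul_apply, smul_eq_mul, abs_mul, abs_of_nonneg hc, mul_rpow hc (abs_nonneg _)]
  unfold pnorm
  rw [h, mul_rpow (rpow_nonneg hc _) (Finset.sum_nonneg fun i _ => rpow_nonneg (abs_nonneg _) _),
    ← rpow_mul hc, mul_one_div_cancel hγ.ne', rpow_one]

lemma pnorm_rpow {s : ℕ} {γ : ℝ} (hγ : 0 < γ) (x : Fin s → ℝ) :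
    pnorm γ x ^ γ = ∑ i, |x i| ^ γ := by
  unfold pnorm
  rw [← rpow_mul (Finset.sum_nonneg fun i _ => rpow_nonneg (abs_nonneg _) _),
    one_div_mul_cancel hγ.ne', rpow_one]

/-- The part of the closed ball of radius `r` lying in the open positive orthant. -/
def orthantBall (s : ℕ) (γ r : ℝ) : Set (Fin s → ℝ) := {x | x ∈ orthant s ∧ pnorm γ x ≤ r}

lemma volume_orthantBall {s : ℕ} {γ : ℝ} (hγ : 0 < γ) {r : ℝ} (hr : 0 < r) :
    volume (orthantBall s γ r) = ENNReal.ofReal (r ^ s) * volume (orthantBall s γ 1) := by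
  have : orthantBall s γ r = r • orthantBall s γ 1 := by
    ext x
    rw [Set.mem_smul_set_iff_inv_smul_mem₀ hr.ne']
    simp only [orthantBall, orthant, mem_ofPred_eq, pnorm_smul hγ (inv_nonneg.2 hr.le),
      Pi.smul_apply, smul_eq_mul]
    refine and_congr (forall_congr' fun i => ?_) ?_
    · rw [mul_pos_iff_of_pos_left (inv_pos.2 hr)]
    · rw [inv_mul_le_iff₀ hr, mul_one]
  rw [this, Measure.addHaar_smul, Module.finrank_fin_fun, abs_of_nonneg (pow_nonneg hr.le _)]

lemma volume_orthantBall_one_lt_top {s : ℕ} {γ : ℝ} (hγ : 0 < γ) :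
    volume (orthantBall s γ 1) < ∞ := by
  refine lt_of_le_of_lt (measure_mono (t := Icc 0 1) ?_) (isCompact_Icc.measure_lt_top)
  rintro x ⟨hx, hx1⟩
  refine ⟨fun i => (hx i).le, fun i => ?_⟩
  have h1 : ∑ i, |x i| ^ γ ≤ 1 := by
    rw [← pnorm_rpow hγ]
    refine rpow_le_one ?_ hx1 hγ.le
    exact rpow_nonneg (Finset.sum_nonneg fun i _ => rpow_nonneg (abs_nonneg _) _) _
  have h2 : |x i| ^ γ ≤ 1 := (Finset.single_le_sum (f := fun i => |x i| ^ γ)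
    (fun i _ => rpow_nonneg (abs_nonneg _) _) (Finset.mem_univ i)).trans h1
  have h3 : |x i| ≤ 1 := by
    by_contra! h
    exact absurd (one_lt_rpow h hγ) (not_lt.2 h2)
  exact (le_abs_self _).trans h3

lemma map_pnorm_Iic {s : ℕ} (hs : 0 < s) {γ : ℝ} (hγ : 0 < γ) (r : ℝ) :
    (volume.restrict (orthant s)).map (pnorm γ) (Iic r) =
      ENNReal.ofReal (max r 0 ^ s) * volume (orthantBall s γ 1) := by
  rw [Measure.map_apply (measurable_pnorm γ) measurableSet_Iic,
    Measure.restrict_apply (measurable_pnorm γ measurableSet_Iic)]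
  rcases le_or_gt r 0 with hr | hr
  · rw [max_eq_right hr, zero_pow hs.ne', ENNReal.ofReal_zero, zero_mul]
    convert measure_empty (μ := (volume : Measure (Fin s → ℝ)))
    ext x
    simp only [mem_inter_iff, mem_preimage, mem_Iic, mem_empty_iff_false, iff_false, not_and]
    exact fun h hx => absurd (pnorm_pos hs γ hx) (not_lt.2 (h.trans hr))
  · rw [max_eq_left hr.le, ← volume_orthantBall hγ hr]
    congr 1
    ext x
    simp [orthantBall, and_comm]

lemma lintegral_Ioc_rpow {s : ℕ} (hs : 0 < s) {r : ℝ} (hr : 0 ≤ r) :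
    ∫⁻ t in Ioc 0 r, ENNReal.ofReal (s * t ^ ((s : ℝ) - 1)) = ENNReal.ofReal (r ^ s) := by
  have hs' : (0 : ℝ) < s := Nat.cast_pos.2 hs
  have hi : IntervalIntegrable (fun t : ℝ => (s : ℝ) * t ^ ((s : ℝ) - 1)) volume 0 r :=
    (intervalIntegral.intervalIntegrable_rpow' (by linarith)).const_mul _
  rw [← ofReal_integral_eq_lintegral_ofReal
    ((intervalIntegrable_iff_integrableOn_Ioc_of_le hr).1 hi),
    ← intervalIntegral.integral_of_le hr, intervalIntegral.integral_const_mul,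
    integral_rpow (Or.inl (by linarith)), sub_add_cancel, zero_rpow hs'.ne', rpow_natCast]
  · congr 1; field_simp; ring
  · filter_upwards [ae_restrict_mem measurableSet_Ioc] with t ht
    exact mul_nonneg hs'.le (rpow_nonneg ht.1.le _)

lemma map_pnorm_eq_withDensity {s : ℕ} (hs : 0 < s) {γ : ℝ} (hγ : 0 < γ) :
    (volume.restrict (orthant s)).map (pnorm γ) =
      volume (orthantBall s γ 1) • (volume.restrict (Ioi 0)).withDensity
        (fun t : ℝ => ENNReal.ofReal (s * t ^ ((s : ℝ) - 1))) := by
  have hV := (volume_orthantBall_one_lt_top (s := s) hγ).ne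
  set μ := (volume.restrict (orthant s)).map (pnorm γ) with hμ
  set ν := volume (orthantBall s γ 1) • (volume.restrict (Ioi 0)).withDensity
        (fun t : ℝ => ENNReal.ofReal (s * t ^ ((s : ℝ) - 1))) with hν
  have h1 : ∀ r, μ (Iic r) = ν (Iic r) := by
    intro r
    rw [hμ, hν, map_pnorm_Iic hs hγ, Measure.smul_apply, withDensity_apply _ measurableSet_Iic,
      Measure.restrict_restrict measurableSet_Iic, inter_comm, Ioi_inter_Iic, smul_eq_mul, mul_comm]
    congr 1
    rcases le_or_gt r 0 with hr | hr
    · rw [Ioc_eq_empty (not_lt.2 hr), max_eq_right hr, zero_pow hs.ne']; simp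
    · rw [lintegral_Ioc_rpow hs hr.le, max_eq_left hr.le]
  have hfin : ∀ r, μ (Iic r) < ∞ := fun r => by
    rw [hμ, map_pnorm_Iic hs hγ]
    exact ENNReal.mul_lt_top ENNReal.ofReal_lt_top hV.lt_top
  have : IsLocallyFiniteMeasure μ := ⟨fun x => ⟨Iic (x + 1), Iic_mem_nhds (by linarith), hfin _⟩⟩
  refine Measure.ext_of_Ioc μ ν fun a b hab => ?_
  have hI : Ioc a b = Iic b \ Iic a := by ext; simp [and_comm]
  rw [hI, measure_sdiff (Iic_subset_Iic.2 hab.le) measurableSet_Iic.nullMeasurableSet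
    (hfin a).ne, measure_sdiff (Iic_subset_Iic.2 hab.le) measurableSet_Iic.nullMeasurableSet
    (h1 a ▸ (hfin a).ne), h1, h1]

/-- The surface constant of the positive part of the unit sphere of `pnorm γ`. -/
noncomputable def sphereConst (s : ℕ) (γ : ℝ) : ℝ :=
  Real.Gamma (1 / γ) ^ s / (γ ^ (s - 1) * Real.Gamma (s / γ))

lemma sphereConst_pos {s : ℕ} (hs : 0 < s) {γ : ℝ} (hγ : 0 < γ) : 0 < sphereConst s γ := by
  have hs' : (0 : ℝ) < s := Nat.cast_pos.2 hs
  unfold sphereConst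
  have := Gamma_pos_of_pos (one_div_pos.2 hγ)
  have := Gamma_pos_of_pos (div_pos hs' hγ)
  positivity

lemma lintegral_pnorm_aux {s : ℕ} (hs : 0 < s) {γ : ℝ} (hγ : 0 < γ) {g : ℝ → ℝ≥0∞}
    (hg : Measurable g) :
    ∫⁻ x in orthant s, g (pnorm γ x) = (volume (orthantBall s γ 1) * s) *
      ∫⁻ t in Ioi (0 : ℝ), ENNReal.ofReal (t ^ ((s : ℝ) - 1)) * g t := by
  rw [← lintegral_map hg (measurable_pnorm γ), map_pnorm_eq_withDensity hs hγ,
    lintegral_smul_measure, lintegral_withDensity_eq_lintegral_mul _ (by fun_prop) hg, mul_assoc,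
    smul_eq_mul]
  congr 1
  rw [← lintegral_const_mul _ (by fun_prop)]
  refine lintegral_congr fun t => ?_
  rw [Pi.mul_apply, ENNReal.ofReal_mul (Nat.cast_nonneg _), ENNReal.ofReal_natCast, mul_assoc]

lemma lintegral_exp_neg_pnorm {s : ℕ} {γ : ℝ} (hγ : 0 < γ) :
    ∫⁻ x in orthant s, ENNReal.ofReal (exp (-pnorm γ x ^ γ)) =
      ENNReal.ofReal (Real.Gamma (1 / γ + 1) ^ s) := by
  have h0 : 0 < Real.Gamma (1 / γ + 1) := Gamma_pos_of_pos (by positivity)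
  have h1 : ∫ x in orthant s, exp (-pnorm γ x ^ γ) = Real.Gamma (1 / γ + 1) ^ s := by
    rw [← integral_exp_neg_rpow hγ, volume_pi, orthant_eq_pi, Measure.restrict_pi_pi]
    conv_rhs => rw [← Fintype.card_fin s]
    rw [← integral_fintype_prod_eq_pow, ← Measure.restrict_pi_pi]
    refine setIntegral_congr_fun (MeasurableSet.univ_pi fun _ => measurableSet_Ioi) fun x hx => ?_
    simp only [pnorm_rpow hγ, ← exp_sum, Finset.sum_neg_distrib]
    congr 2
    refine Finset.sum_congr rfl fun i _ => ?_
    rw [abs_of_pos (hx i trivial)]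
  rw [← h1, ofReal_integral_eq_lintegral_ofReal]
  · by_contra h
    rw [integral_undef h] at h1
    exact absurd h1 (pow_pos h0 _).ne
  · exact ae_of_all _ fun x => (exp_pos _).le

lemma volume_orthantBall_one_mul {s : ℕ} (hs : 0 < s) {γ : ℝ} (hγ : 0 < γ) :
    volume (orthantBall s γ 1) * s = ENNReal.ofReal (sphereConst s γ) := by
  have hs' : (0 : ℝ) < s := Nat.cast_pos.2 hs
  have hG : 0 < Real.Gamma (s / γ) := Gamma_pos_of_pos (div_pos hs' hγ)
  have hGi : ∫ t in Ioi (0 : ℝ), t ^ ((s : ℝ) - 1) * exp (-t ^ γ) =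
      1 / γ * Real.Gamma (s / γ) := by
    rw [integral_rpow_mul_exp_neg_rpow hγ (by linarith), sub_add_cancel]
  have h := lintegral_pnorm_aux hs hγ (g := fun t => ENNReal.ofReal (exp (-t ^ γ))) (by fun_prop)
  have h2 : ∫⁻ t in Ioi (0 : ℝ), ENNReal.ofReal (t ^ ((s : ℝ) - 1)) *
      ENNReal.ofReal (exp (-t ^ γ)) = ENNReal.ofReal (1 / γ * Real.Gamma (s / γ)) := by
    rw [← hGi, ofReal_integral_eq_lintegral_ofReal]
    · exact setLIntegral_congr_fun measurableSet_Ioi fun t ht =>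
        (ENNReal.ofReal_mul (rpow_nonneg (le_of_lt ht) _)).symm
    · by_contra h
      rw [integral_undef h] at hGi
      have : 0 < 1 / γ * Real.Gamma (s / γ) := by positivity
      exact absurd hGi this.ne
    · filter_upwards [ae_restrict_mem measurableSet_Ioi] with t ht
      exact mul_nonneg (rpow_nonneg (le_of_lt ht) _) (exp_pos _).le
  rw [h2, lintegral_exp_neg_pnorm hγ] at h
  have h3 : Real.Gamma (1 / γ + 1) ^ s =
      sphereConst s γ * (1 / γ * Real.Gamma (s / γ)) := by
    obtain ⟨k, rfl⟩ : ∃ k, s = k + 1 := ⟨s - 1, by omega⟩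
    rw [Gamma_add_one (by positivity), sphereConst, Nat.add_sub_cancel, mul_pow, one_div_pow]
    field_simp
    ring
  rw [h3, ENNReal.ofReal_mul (sphereConst_pos hs hγ).le] at h
  exact ((ENNReal.mul_left_inj (by simpa using by positivity) ENNReal.ofReal_ne_top).1 h).symm

/-- Integration of a radial function over the positive orthant. -/
lemma lintegral_pnorm {s : ℕ} (hs : 0 < s) {γ : ℝ} (hγ : 0 < γ) {g : ℝ → ℝ≥0∞}
    (hg : Measurable g) :
    ∫⁻ x in orthant s, g (pnorm γ x) = ENNReal.ofReal (sphereConst s γ) *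
      ∫⁻ t in Ioi (0 : ℝ), ENNReal.ofReal (t ^ ((s : ℝ) - 1)) * g t := by
  rw [lintegral_pnorm_aux hs hγ hg, volume_orthantBall_one_mul hs hγ]


lemma measurable_cothR : Measurable cothR := by
  unfold cothR
  fun_prop

lemma hasSum_cothR_sub_one {v : ℝ} (hv : 0 < v) :
    HasSum (fun j : ℕ => 2 * exp (-(2 * ((j : ℝ) + 1) * v))) (cothR v - 1) := by
  have h1 : exp (-(2 * v)) < 1 := Real.exp_zero ▸ Real.exp_lt_exp.2 (by linarith)
  have h := (hasSum_geometric_of_lt_one (exp_pos _).le h1).mul_left (2 * exp (-(2 * v)))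
  have h0 : (fun j : ℕ => 2 * exp (-(2 * ((j : ℝ) + 1) * v))) =
      fun j : ℕ => 2 * exp (-(2 * v)) * exp (-(2 * v)) ^ j := by
    funext j
    rw [mul_assoc (2 : ℝ) (exp _), ← exp_nat_mul, ← exp_add]
    congr 2
    ring
  have h2 : exp (-(2 * v)) = exp (-v) * exp (-v) := by rw [← exp_add]; congr 1; ring
  have h3 : exp v * exp (-v) = 1 := by rw [← exp_add]; simp
  have h4 : exp (-v) < exp v := exp_lt_exp.2 (by linarith)
  have h5 : exp v - exp (-v) ≠ 0 := by linarith
  have h6 : 1 - exp (-(2 * v)) ≠ 0 := by linarith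
  have h7 : cothR v - 1 = 2 * exp (-(2 * v)) * (1 - exp (-(2 * v)))⁻¹ := by
    unfold cothR
    rw [← div_eq_mul_inv, div_sub_one h5, div_eq_div_iff h5 h6, h2]
    linear_combination (-2 * exp (-v)) * h3
  rw [h0, h7]
  exact h

lemma cothR_sub_one_nonneg {v : ℝ} (hv : 0 < v) : 0 ≤ cothR v - 1 :=
  (hasSum_cothR_sub_one hv).nonneg fun _ => by positivity

/-- The Mellin transform of `coth - 1` at `σ`. -/
noncomputable def mellinCoth (σ : ℝ) : ℝ := Real.Gamma σ / 2 ^ (σ - 1) * zetaR σ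

lemma zetaR_eq (σ : ℝ) : zetaR σ = ∑' j : ℕ, ((j : ℝ) + 1) ^ (-σ) := by
  unfold zetaR
  rw [tsum_pnat_eq_tsum_succ (f := fun n : ℕ => (n : ℝ) ^ (-σ))]
  simp

lemma summable_zetaR {σ : ℝ} (hσ : 1 < σ) : Summable fun j : ℕ => ((j : ℝ) + 1) ^ (-σ) := by
  have := (summable_nat_add_iff 1).2 (Real.summable_nat_rpow.2 (show -σ < -1 by linarith))
  simpa using this

lemma mellinCoth_pos {σ : ℝ} (hσ : 1 < σ) : 0 < mellinCoth σ := by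
  have h1 : 0 < zetaR σ := by
    rw [zetaR_eq]
    exact (summable_zetaR hσ).tsum_pos (fun _ => by positivity) 0 (by simp)
  have := Gamma_pos_of_pos (zero_lt_one.trans hσ)
  unfold mellinCoth
  positivity

lemma lintegral_cothR {σ : ℝ} (hσ : 1 < σ) :
    ∫⁻ t in Ioi (0 : ℝ), ENNReal.ofReal ((cothR t - 1) * t ^ (σ - 1)) =
      ENNReal.ofReal (mellinCoth σ) := by
  have hσ0 : 0 < σ := by linarith
  have hG := Gamma_pos_of_pos hσ0
  have h1 : ∀ j : ℕ, ∫⁻ t in Ioi (0 : ℝ),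
      ENNReal.ofReal (2 * exp (-(2 * ((j : ℝ) + 1) * t)) * t ^ (σ - 1)) =
      ENNReal.ofReal (Real.Gamma σ / 2 ^ (σ - 1) * ((j : ℝ) + 1) ^ (-σ)) := by
    intro j
    have hj : (0 : ℝ) < (j : ℝ) + 1 := by positivity
    have h2 : ∫ t in Ioi (0 : ℝ), 2 * exp (-(2 * ((j : ℝ) + 1) * t)) * t ^ (σ - 1) =
        Real.Gamma σ / 2 ^ (σ - 1) * ((j : ℝ) + 1) ^ (-σ) := by
      have h3 := Real.integral_rpow_mul_exp_neg_mul_Ioi hσ0 (show 0 < 2 * ((j : ℝ) + 1) by positivity)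
      have h4 : ∀ t : ℝ, 2 * exp (-(2 * ((j : ℝ) + 1) * t)) * t ^ (σ - 1) =
        2 * (t ^ (σ - 1) * exp (-(2 * ((j : ℝ) + 1) * t))) := fun t => by ring
      simp_rw [h4]
      rw [integral_const_mul, h3, one_div, inv_rpow (by positivity), mul_rpow (by norm_num) hj.le,
        rpow_neg hj.le, rpow_sub_one (by norm_num)]
      field_simp
    rw [← h2, ofReal_integral_eq_lintegral_ofReal]
    · by_contra h
      rw [integral_undef h] at h2
      have : 0 < Real.Gamma σ / 2 ^ (σ - 1) * ((j : ℝ) + 1) ^ (-σ) := by positivity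
      exact absurd h2 this.ne
    · filter_upwards [ae_restrict_mem measurableSet_Ioi] with t ht
      exact mul_nonneg (by positivity) (rpow_nonneg (le_of_lt ht) _)
  calc _ = ∫⁻ t in Ioi (0 : ℝ), ∑' j : ℕ,
        ENNReal.ofReal (2 * exp (-(2 * ((j : ℝ) + 1) * t)) * t ^ (σ - 1)) := by
        refine setLIntegral_congr_fun measurableSet_Ioi fun t ht => ?_
        have h := (hasSum_cothR_sub_one ht).mul_right (t ^ (σ - 1))
        rw [← h.tsum_eq, ENNReal.ofReal_tsum_of_nonneg _ h.summable]
        exact fun j => mul_nonneg (by positivity) (rpow_nonneg (le_of_lt ht) _)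
    _ = _ := by
        rw [lintegral_tsum fun j => by fun_prop]
        simp_rw [h1]
        rw [← ENNReal.ofReal_tsum_of_nonneg (fun j => by positivity)
          ((summable_zetaR hσ).mul_left _), tsum_mul_left, mellinCoth, zetaR_eq]

lemma lintegral_Ioi_comp_mul_left {c : ℝ} (hc : 0 < c) (F : ℝ → ℝ≥0∞) :
    ∫⁻ t in Ioi (0 : ℝ), F t = ∫⁻ t in Ioi (0 : ℝ), ENNReal.ofReal c * F (c * t) := by
  have h := lintegral_image_eq_lintegral_abs_deriv_mul (s := Ioi (0 : ℝ)) (f := fun t => c * t)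
    (f' := fun _ => c) measurableSet_Ioi
    (fun x _ => by simpa using! ((hasDerivAt_id x).const_mul c).hasDerivWithinAt)
    (fun x _ y _ h => mul_left_cancel₀ hc.ne' h) F
  rw [abs_of_pos hc] at h
  rw [← h]
  congr 2
  ext x
  simp only [mem_Ioi, mem_image]
  exact ⟨fun hx => ⟨x / c, div_pos hx hc, by field_simp⟩, by rintro ⟨y, hy, rfl⟩; exact mul_pos hc hy⟩

lemma lintegral_Ioi_comp_div {c : ℝ} (hc : 0 < c) (F : ℝ → ℝ≥0∞) :
    ∫⁻ t in Ioi (0 : ℝ), F t = ∫⁻ t in Ioi (0 : ℝ), ENNReal.ofReal (c / t ^ 2) * F (c / t) := by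
  have h := lintegral_image_eq_lintegral_abs_deriv_mul (s := Ioi (0 : ℝ)) (f := fun t => c / t)
    (f' := fun t => -(c / t ^ 2)) measurableSet_Ioi
    (fun x hx => by
      have := ((hasDerivAt_inv (ne_of_gt hx)).const_mul c).hasDerivWithinAt (s := Ioi 0)
      simpa [div_eq_mul_inv] using this)
    (fun x hx y hy h => by
      have hx' : x ≠ 0 := ne_of_gt hx
      have hy' : y ≠ 0 := ne_of_gt hy
      simp only at h
      field_simp at h
      exact h.symm) F
  have hI : (fun t => c / t) '' Ioi 0 = Ioi 0 := by
    ext x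
    simp only [mem_Ioi, mem_image]
    exact ⟨by rintro ⟨y, hy, rfl⟩; exact div_pos hc hy,
      fun hx => ⟨c / x, div_pos hc hx, div_div_cancel₀ hc.ne'⟩⟩
  rw [hI] at h
  rw [h]
  refine setLIntegral_congr_fun measurableSet_Ioi fun t ht => ?_
  rw [abs_neg, abs_of_nonneg (div_nonneg hc.le (sq_nonneg t))]

lemma lintegral_cothR_left {m : ℕ} (hm : 0 < m) {α σ : ℝ} (hα : 0 < α) (hσ : 1 < σ)
    {c : ℝ} (hc : 0 < c) :
    ∫⁻ x in orthant m, ENNReal.ofReal ((cothR (pnorm α x / c) - 1) * pnorm α x ^ (σ - m)) =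
      ENNReal.ofReal (sphereConst m α * mellinCoth σ * c ^ σ) := by
  have hmeas : Measurable fun t => ENNReal.ofReal ((cothR (t / c) - 1) * t ^ (σ - m)) := by
    have := measurable_cothR
    fun_prop
  rw [lintegral_pnorm hm hα hmeas, mul_assoc, ENNReal.ofReal_mul (sphereConst_pos hm hα).le,
    lintegral_Ioi_comp_mul_left hc, mul_comm (mellinCoth σ),
    ENNReal.ofReal_mul (rpow_nonneg hc.le _), ← lintegral_cothR hσ,
    ← lintegral_const_mul' (ENNReal.ofReal (c ^ σ)) _ ENNReal.ofReal_ne_top]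
  congr 1
  refine setLIntegral_congr_fun measurableSet_Ioi fun t ht => ?_
  have ht' : 0 < t := ht
  have h0 := cothR_sub_one_nonneg ht'
  rw [← ENNReal.ofReal_mul (by positivity), ← ENNReal.ofReal_mul (by positivity),
    ← ENNReal.ofReal_mul (by positivity), mul_div_cancel_left₀ _ hc.ne']
  congr 1
  have e : (c * t) ^ ((m : ℝ) - 1) * (c * t) ^ (σ - m) = (c * t) ^ (σ - 1) := by
    rw [← rpow_add (by positivity)]; congr 1; ring
  calc _ = c * (cothR t - 1) * ((c * t) ^ ((m : ℝ) - 1) * (c * t) ^ (σ - m)) := by ring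
    _ = _ := by
      rw [e, mul_rpow hc.le ht'.le, rpow_sub_one hc.ne']
      field_simp

lemma lintegral_cothR_right {n : ℕ} (hn : 0 < n) {β σ : ℝ} (hβ : 0 < β) (hσ : 1 < σ)
    {c : ℝ} (hc : 0 < c) :
    ∫⁻ y in orthant n, ENNReal.ofReal ((cothR (c / pnorm β y) - 1) * pnorm β y ^ (-σ - n)) =
      ENNReal.ofReal (sphereConst n β * mellinCoth σ * c ^ (-σ)) := by
  have hmeas : Measurable fun t => ENNReal.ofReal ((cothR (c / t) - 1) * t ^ (-σ - n)) := by
    have := measurable_cothR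
    fun_prop
  rw [lintegral_pnorm hn hβ hmeas, mul_assoc, ENNReal.ofReal_mul (sphereConst_pos hn hβ).le,
    lintegral_Ioi_comp_div hc, mul_comm (mellinCoth σ),
    ENNReal.ofReal_mul (rpow_nonneg hc.le _), ← lintegral_cothR hσ,
    ← lintegral_const_mul' (ENNReal.ofReal (c ^ (-σ))) _ ENNReal.ofReal_ne_top]
  congr 1
  refine setLIntegral_congr_fun measurableSet_Ioi fun t ht => ?_
  have ht' : 0 < t := ht
  have h0 := cothR_sub_one_nonneg ht'
  rw [← ENNReal.ofReal_mul (by positivity), ← ENNReal.ofReal_mul (by positivity),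
    ← ENNReal.ofReal_mul (by positivity), div_div_cancel₀ hc.ne']
  congr 1
  have e : (c / t) ^ ((n : ℝ) - 1) * (c / t) ^ (-σ - n) = (c / t) ^ (-σ - 1) := by
    rw [← rpow_add (by positivity)]; congr 1; ring
  calc _ = c / t ^ 2 * (cothR t - 1) * ((c / t) ^ ((n : ℝ) - 1) * (c / t) ^ (-σ - n)) := by ring
    _ = _ := by
      rw [e, div_rpow hc.le ht'.le, rpow_sub_one hc.ne', rpow_sub_one ht'.ne',
        rpow_sub_one ht'.ne', rpow_neg ht'.le]
      field_simp

lemma measurable_cothR_sub_one_pnorm {m : ℕ} (α c : ℝ) :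
    Measurable fun x : Fin m → ℝ => cothR (pnorm α x / c) - 1 :=
  (measurable_cothR.comp ((measurable_pnorm α).div_const c)).sub_const 1

lemma measurable_cothR_sub_one_pnorm_prod {m n : ℕ} (α β : ℝ) :
    Measurable fun z : (Fin n → ℝ) × (Fin m → ℝ) => cothR (pnorm α z.2 / pnorm β z.1) - 1 :=
  (measurable_cothR.comp (((measurable_pnorm α).comp measurable_snd).div
    ((measurable_pnorm β).comp measurable_fst))).sub_const 1

/-- Pointwise Hölder estimate for the operator with kernel `coth - 1`. -/
lemma lintegral_cothR_mul_rpow_le {m : ℕ} (hm : 0 < m) {α σ p : ℝ} (hα : 0 < α) (hσ : 1 < σ)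
    (hp : 1 < p) {F : (Fin m → ℝ) → ℝ≥0∞} (hF : Measurable F) {c : ℝ} (hc : 0 < c) :
    (∫⁻ x in orthant m, ENNReal.ofReal (cothR (pnorm α x / c) - 1) * F x) ^ p ≤
      ENNReal.ofReal ((sphereConst m α * mellinCoth σ * c ^ σ) ^ (p - 1)) *
      ∫⁻ x in orthant m, ENNReal.ofReal
        ((cothR (pnorm α x / c) - 1) * pnorm α x ^ ((m - σ) * (p - 1))) * F x ^ p := by
  have hp0 : 0 < p := by linarith
  have hp1 : 0 < p - 1 := by linarith
  set q := p / (p - 1) with hq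
  have hpq : p.HolderConjugate q := Real.HolderConjugate.conjExponent hp
  have hq0 : 0 < q := hpq.symm.pos
  have hqp : 1 / q * p = p - 1 := by rw [hq]; field_simp
  have hpos : 0 < sphereConst m α * mellinCoth σ * c ^ σ :=
    mul_pos (mul_pos (sphereConst_pos hm hα) (mellinCoth_pos hσ)) (rpow_pos_of_pos hc _)
  have hk := measurable_cothR_sub_one_pnorm (m := m) α c
  have hn := measurable_pnorm (s := m) α
  set u : (Fin m → ℝ) → ℝ≥0∞ := fun x => ENNReal.ofReal
    ((cothR (pnorm α x / c) - 1) ^ (1 / p) * pnorm α x ^ ((m - σ) / q)) * F x with hu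
  set v : (Fin m → ℝ) → ℝ≥0∞ := fun x => ENNReal.ofReal
    ((cothR (pnorm α x / c) - 1) ^ (1 / q) * pnorm α x ^ (-((m - σ) / q))) with hv
  have h1 : ∫⁻ x in orthant m, ENNReal.ofReal (cothR (pnorm α x / c) - 1) * F x =
      ∫⁻ x in orthant m, (u * v) x := by
    refine setLIntegral_congr_fun (measurableSet_orthant m) fun x hx => ?_
    have hx0 := pnorm_pos hm α hx
    have hk0 := cothR_sub_one_nonneg (div_pos hx0 hc)
    simp only [hu, hv, Pi.mul_apply]
    rw [mul_right_comm, ← ENNReal.ofReal_mul (by positivity)]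
    congr 2
    have e1 : (cothR (pnorm α x / c) - 1) ^ (1 / p) * (cothR (pnorm α x / c) - 1) ^ (1 / q) =
        cothR (pnorm α x / c) - 1 := by
      rw [← rpow_add_of_nonneg hk0 (by positivity) (by positivity), one_div, one_div,
        hpq.inv_add_inv_eq_one, rpow_one]
    have e2 : pnorm α x ^ ((m - σ) / q) * pnorm α x ^ (-((m - σ) / q)) = 1 := by
      rw [← rpow_add hx0, add_neg_cancel, rpow_zero]
    rw [mul_mul_mul_comm, e1, e2, mul_one]
  have h2 : ∫⁻ x in orthant m, v x ^ q =
      ENNReal.ofReal (sphereConst m α * mellinCoth σ * c ^ σ) := by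
    rw [← lintegral_cothR_left hm hα hσ hc]
    refine setLIntegral_congr_fun (measurableSet_orthant m) fun x hx => ?_
    have hx0 := pnorm_pos hm α hx
    have hk0 := cothR_sub_one_nonneg (div_pos hx0 hc)
    simp only [hv]
    rw [ENNReal.ofReal_rpow_of_nonneg (by positivity) hq0.le, mul_rpow (by positivity)
      (by positivity), ← rpow_mul hk0, ← rpow_mul hx0.le, one_div_mul_cancel hq0.ne', rpow_one]
    congr 3
    field_simp
    ring
  have h3 : ∫⁻ x in orthant m, u x ^ p = ∫⁻ x in orthant m, ENNReal.ofReal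
        ((cothR (pnorm α x / c) - 1) * pnorm α x ^ ((m - σ) * (p - 1))) * F x ^ p := by
    refine setLIntegral_congr_fun (measurableSet_orthant m) fun x hx => ?_
    have hx0 := pnorm_pos hm α hx
    have hk0 := cothR_sub_one_nonneg (div_pos hx0 hc)
    simp only [hu]
    rw [ENNReal.mul_rpow_of_nonneg _ _ hp0.le,
      ENNReal.ofReal_rpow_of_nonneg (by positivity) hp0.le, mul_rpow (by positivity)
      (by positivity), ← rpow_mul hk0, ← rpow_mul hx0.le, one_div_mul_cancel hp0.ne', rpow_one]
    congr 4
    rw [← hqp]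
    ring
  have h4 := ENNReal.lintegral_mul_le_Lp_mul_Lq (volume.restrict (orthant m)) hpq
    (f := u) (g := v) (by fun_prop) (by fun_prop)
  rw [← h1, h2, h3] at h4
  refine (ENNReal.rpow_le_rpow h4 hp0.le).trans_eq ?_
  rw [ENNReal.mul_rpow_of_nonneg _ _ hp0.le, ← ENNReal.rpow_mul, ← ENNReal.rpow_mul,
    one_div_mul_cancel hp0.ne', ENNReal.rpow_one, hqp,
    ENNReal.ofReal_rpow_of_nonneg hpos.le hp1.le, mul_comm]

/-- Schur test for the kernel `coth - 1`. -/
lemma lintegral_cothR_operator_le {m n : ℕ} (hm : 0 < m) (hn : 0 < n) {α β σ p : ℝ} (hα : 0 < α)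
    (hβ : 0 < β) (hσ : 1 < σ) (hp : 1 < p) {F : (Fin m → ℝ) → ℝ≥0∞} (hF : Measurable F) :
    ∫⁻ y in orthant n, ENNReal.ofReal (pnorm β y ^ (-(p * σ) - n)) *
        (∫⁻ x in orthant m, ENNReal.ofReal (cothR (pnorm α x / pnorm β y) - 1) * F x) ^ p ≤
      ENNReal.ofReal (sphereConst n β * mellinCoth σ *
        (sphereConst m α * mellinCoth σ) ^ (p - 1)) *
      ∫⁻ x in orthant m, ENNReal.ofReal (pnorm α x ^ (p * (m - σ) - m)) * F x ^ p := by
  have hM := mellinCoth_pos hσ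
  have hCm := sphereConst_pos hm hα
  have hCn := sphereConst_pos hn hβ
  have hk := measurable_cothR_sub_one_pnorm_prod (m := m) (n := n) α β
  have hnm := measurable_pnorm (s := m) α
  have hnn := measurable_pnorm (s := n) β
  set D : ℝ := (sphereConst m α * mellinCoth σ) ^ (p - 1) with hD
  have hD0 : 0 ≤ D := by positivity
  have hmeas : Measurable fun z : (Fin n → ℝ) × (Fin m → ℝ) =>
      ENNReal.ofReal (D * pnorm β z.1 ^ (-σ - n)) * (ENNReal.ofReal
        ((cothR (pnorm α z.2 / pnorm β z.1) - 1) *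
          pnorm α z.2 ^ ((m - σ) * (p - 1))) * F z.2 ^ p) := by fun_prop
  calc _ ≤ ∫⁻ y in orthant n, ∫⁻ x in orthant m,
        ENNReal.ofReal (D * pnorm β y ^ (-σ - n)) * (ENNReal.ofReal
        ((cothR (pnorm α x / pnorm β y) - 1) *
          pnorm α x ^ ((m - σ) * (p - 1))) * F x ^ p) := by
        refine setLIntegral_mono' (measurableSet_orthant n) fun y hy => ?_
        have hy0 := pnorm_pos hn β hy
        rw [lintegral_const_mul' _ _ ENNReal.ofReal_ne_top]
        refine (mul_le_mul_right (lintegral_cothR_mul_rpow_le hm hα hσ hp hF hy0) _).trans_eq ?_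
        rw [← mul_assoc, ← ENNReal.ofReal_mul (by positivity)]
        congr 2
        rw [mul_rpow (by positivity) (by positivity), ← rpow_mul hy0.le, mul_left_comm,
          ← rpow_add hy0]
        congr 2
        ring
    _ = ∫⁻ x in orthant m, ∫⁻ y in orthant n,
        ENNReal.ofReal (D * pnorm β y ^ (-σ - n)) * (ENNReal.ofReal
        ((cothR (pnorm α x / pnorm β y) - 1) *
          pnorm α x ^ ((m - σ) * (p - 1))) * F x ^ p) :=
        lintegral_lintegral_swap hmeas.aemeasurable
    _ = _ := by
        rw [← lintegral_const_mul' _ _ ENNReal.ofReal_ne_top]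
        refine setLIntegral_congr_fun (measurableSet_orthant m) fun x hx => ?_
        have hx0 := pnorm_pos hm α hx
        have h1 : ∫⁻ y in orthant n, ENNReal.ofReal (D * pnorm β y ^ (-σ - n)) * (ENNReal.ofReal
            ((cothR (pnorm α x / pnorm β y) - 1) *
              pnorm α x ^ ((m - σ) * (p - 1))) * F x ^ p) =
            ∫⁻ y in orthant n, (ENNReal.ofReal (D * pnorm α x ^ ((m - σ) * (p - 1))) * F x ^ p) *
              ENNReal.ofReal ((cothR (pnorm α x / pnorm β y) - 1) * pnorm β y ^ (-σ - n)) := by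
          refine setLIntegral_congr_fun (measurableSet_orthant n) fun y hy => ?_
          have hy0 := pnorm_pos hn β hy
          have hk0 := cothR_sub_one_nonneg (div_pos hx0 hy0)
          rw [← mul_assoc, ← ENNReal.ofReal_mul (by positivity),
            mul_right_comm _ (F x ^ p),
            ← ENNReal.ofReal_mul (by positivity)]
          congr 2
          ring
        have hk1 : Measurable fun y => cothR (pnorm α x / pnorm β y) - 1 :=
          (measurable_cothR.comp (hnn.const_div _)).sub_const 1
        rw [h1, lintegral_const_mul _ (by fun_prop), lintegral_cothR_right hn hβ hσ hx0,
          mul_right_comm, ← ENNReal.ofReal_mul (by positivity),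
          ← mul_assoc (ENNReal.ofReal _) (ENNReal.ofReal _) (F x ^ p),
          ← ENNReal.ofReal_mul (by positivity)]
        congr 2
        have e : pnorm α x ^ ((m - σ) * (p - 1)) * pnorm α x ^ (-σ) =
            pnorm α x ^ (p * (m - σ) - m) := by
          rw [← rpow_add hx0]; congr 1; ring
        rw [← e]
        ring

/-- The operator norm. -/
noncomputable def cothNorm (m n : ℕ) (α β σ p q : ℝ) : ℝ :=
  sphereConst n β ^ (1 / p) * sphereConst m α ^ (1 / q) * mellinCoth σ

lemma cothNorm_pos {m n : ℕ} (hm : 0 < m) (hn : 0 < n) {α β σ : ℝ} (p q : ℝ) (hα : 0 < α)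
    (hβ : 0 < β) (hσ : 1 < σ) : 0 < cothNorm m n α β σ p q := by
  have hM := mellinCoth_pos hσ
  have hCm := sphereConst_pos hm hα
  have hCn := sphereConst_pos hn hβ
  unfold cothNorm
  positivity

lemma cothNorm_rpow {m n : ℕ} (hm : 0 < m) (hn : 0 < n) {α β σ p q : ℝ} (hα : 0 < α)
    (hβ : 0 < β) (hσ : 1 < σ) (hp : 1 < p) (hpq : 1 / p + 1 / q = 1) :
    cothNorm m n α β σ p q ^ p =
      sphereConst n β * mellinCoth σ * (sphereConst m α * mellinCoth σ) ^ (p - 1) := by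
  have hM := mellinCoth_pos hσ
  have hCm := sphereConst_pos hm hα
  have hCn := sphereConst_pos hn hβ
  have hp0 : p ≠ 0 := by linarith
  have hq : 1 / q * p = p - 1 := by
    rw [show 1 / q = 1 - 1 / p by linarith]; field_simp
  unfold cothNorm
  rw [mul_rpow (by positivity) hM.le, mul_rpow (by positivity) (by positivity), ← rpow_mul hCn.le,
    ← rpow_mul hCm.le, hq, one_div_mul_cancel hp0, rpow_one, mul_rpow hCm.le hM.le,
    rpow_sub_one hM.ne']
  field_simp

lemma ofReal_mul_abs_rpow {w a p : ℝ} (hw : 0 ≤ w) (hp : 0 ≤ p) :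
    ENNReal.ofReal (w * |a| ^ p) = ENNReal.ofReal w * ENNReal.ofReal |a| ^ p := by
  rw [ENNReal.ofReal_mul hw, ENNReal.ofReal_rpow_of_nonneg (abs_nonneg _) hp]

lemma lintegral_cothR_operator_le_ofReal {m n : ℕ} (hm : 0 < m) (hn : 0 < n) {α β σ p q : ℝ}
    (hα : 0 < α) (hβ : 0 < β) (hσ : 1 < σ) (hp : 1 < p) (hpq : 1 / p + 1 / q = 1)
    {f : (Fin m → ℝ) → ℝ} (hf : Measurable f)
    (hfi : IntegrableOn (fun x => pnorm α x ^ (p * (m - σ) - m) * |f x| ^ p) (orthant m)) :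
    ∫⁻ y in orthant n, ENNReal.ofReal (pnorm β y ^ (-(p * σ) - n)) *
        (∫⁻ x in orthant m, ENNReal.ofReal (cothR (pnorm α x / pnorm β y) - 1) *
          ENNReal.ofReal |f x|) ^ p ≤
      ENNReal.ofReal (cothNorm m n α β σ p q ^ p *
        ∫ x in orthant m, pnorm α x ^ (p * (m - σ) - m) * |f x| ^ p) := by
  have h := lintegral_cothR_operator_le hm hn hα hβ hσ hp
    (F := fun x => ENNReal.ofReal |f x|) (by fun_prop)
  rw [← cothNorm_rpow hm hn hα hβ hσ hp hpq] at h
  refine h.trans_eq ?_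
  rw [ENNReal.ofReal_mul (rpow_nonneg (cothNorm_pos hm hn p q hα hβ hσ).le _),
    ofReal_integral_eq_lintegral_ofReal hfi]
  · congr 1
    refine setLIntegral_congr_fun (measurableSet_orthant m) fun x hx => ?_
    exact (ofReal_mul_abs_rpow (rpow_nonneg (pnorm_pos hm α hx).le _) (by linarith)).symm
  · filter_upwards [ae_restrict_mem (measurableSet_orthant m)] with x hx
    exact mul_nonneg (rpow_nonneg (pnorm_pos hm α hx).le _) (rpow_nonneg (abs_nonneg _) _)

lemma ofReal_abs_integral_cothR_le {m : ℕ} (hm : 0 < m) {α c : ℝ} (hc : 0 < c)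
    (f : (Fin m → ℝ) → ℝ) :
    ENNReal.ofReal |∫ x in orthant m, (cothR (pnorm α x / c) - 1) * f x| ≤
      ∫⁻ x in orthant m, ENNReal.ofReal (cothR (pnorm α x / c) - 1) * ENNReal.ofReal |f x| := by
  rw [← Real.norm_eq_abs, ofReal_norm]
  refine (enorm_integral_le_lintegral_enorm _).trans_eq ?_
  refine setLIntegral_congr_fun (measurableSet_orthant m) fun x hx => ?_
  have hk0 := cothR_sub_one_nonneg (div_pos (pnorm_pos hm α hx) hc)
  rw [← ofReal_norm, Real.norm_eq_abs, abs_mul, abs_of_nonneg hk0, ENNReal.ofReal_mul hk0]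

lemma integral_pnorm_mul_rpow_nonneg {m : ℕ} (hm : 0 < m) (α r p : ℝ) (f : (Fin m → ℝ) → ℝ) :
    0 ≤ ∫ x in orthant m, pnorm α x ^ r * |f x| ^ p :=
  setIntegral_nonneg (measurableSet_orthant m) fun _ hx =>
    mul_nonneg (rpow_nonneg (pnorm_pos hm α hx).le _) (rpow_nonneg (abs_nonneg _) _)

lemma lintegral_cothR_integral_operator_le {m n : ℕ} (hm : 0 < m) (hn : 0 < n) {α β σ p q : ℝ}
    (hα : 0 < α) (hβ : 0 < β) (hσ : 1 < σ) (hp : 1 < p) (hpq : 1 / p + 1 / q = 1)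
    {f : (Fin m → ℝ) → ℝ} (hf : Measurable f)
    (hfi : IntegrableOn (fun x => pnorm α x ^ (p * (m - σ) - m) * |f x| ^ p) (orthant m)) :
    ∫⁻ y in orthant n, ‖pnorm β y ^ (-(p * σ) - n) *
        |∫ x in orthant m, (cothR (pnorm α x / pnorm β y) - 1) * f x| ^ p‖ₑ ≤
      ENNReal.ofReal (cothNorm m n α β σ p q ^ p *
        ∫ x in orthant m, pnorm α x ^ (p * (m - σ) - m) * |f x| ^ p) := by
  refine le_trans ?_ (lintegral_cothR_operator_le_ofReal hm hn hα hβ hσ hp hpq hf hfi)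
  refine setLIntegral_mono' (measurableSet_orthant n) fun y hy => ?_
  have hy0 := pnorm_pos hn β hy
  rw [← ofReal_norm, Real.norm_eq_abs, abs_of_nonneg (by positivity),
    ofReal_mul_abs_rpow (by positivity) (by linarith)]
  gcongr
  exact ofReal_abs_integral_cothR_le hm hy0 f

/-- Boundedness of the operator. -/
lemma integral_cothR_operator_le {m n : ℕ} (hm : 0 < m) (hn : 0 < n) {α β σ p q : ℝ}
    (hα : 0 < α) (hβ : 0 < β) (hσ : 1 < σ) (hp : 1 < p) (hpq : 1 / p + 1 / q = 1)
    {f : (Fin m → ℝ) → ℝ} (hf : Measurable f)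
    (hfi : IntegrableOn (fun x => pnorm α x ^ (p * (m - σ) - m) * |f x| ^ p) (orthant m)) :
    ∫ y in orthant n, pnorm β y ^ (-(p * σ) - n) *
        |∫ x in orthant m, (cothR (pnorm α x / pnorm β y) - 1) * f x| ^ p ≤
      cothNorm m n α β σ p q ^ p *
        ∫ x in orthant m, pnorm α x ^ (p * (m - σ) - m) * |f x| ^ p := by
  have hK := cothNorm_pos hm hn p q hα hβ hσ
  have hI := integral_pnorm_mul_rpow_nonneg hm α (p * (m - σ) - m) p f
  refine (le_abs_self _).trans ?_
  rw [← Real.norm_eq_abs, ← ENNReal.ofReal_le_ofReal_iff (by positivity), ofReal_norm]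
  exact (enorm_integral_le_lintegral_enorm _).trans
    (lintegral_cothR_integral_operator_le hm hn hα hβ hσ hp hpq hf hfi)

lemma integrableOn_cothR_operator {m n : ℕ} (hm : 0 < m) (hn : 0 < n) {α β σ p q : ℝ}
    (hα : 0 < α) (hβ : 0 < β) (hσ : 1 < σ) (hp : 1 < p) (hpq : 1 / p + 1 / q = 1)
    {f : (Fin m → ℝ) → ℝ} (hf : Measurable f)
    (hfi : IntegrableOn (fun x => pnorm α x ^ (p * (m - σ) - m) * |f x| ^ p) (orthant m)) :
    IntegrableOn (fun y => pnorm β y ^ (-(p * σ) - n) *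
        |∫ x in orthant m, (cothR (pnorm α x / pnorm β y) - 1) * f x| ^ p) (orthant n) := by
  refine ⟨?_, (lintegral_cothR_integral_operator_le hm hn hα hβ hσ hp hpq hf hfi).trans_lt
    ENNReal.ofReal_lt_top⟩
  have h1 : Measurable fun z : (Fin n → ℝ) × (Fin m → ℝ) =>
      (cothR (pnorm α z.2 / pnorm β z.1) - 1) * f z.2 :=
    (measurable_cothR_sub_one_pnorm_prod α β).mul (hf.comp measurable_snd)
  have h2 := (h1.stronglyMeasurable.integral_prod_right'
    (ν := volume.restrict (orthant m))).measurable
  have h3 := measurable_pnorm (s := n) β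
  exact ((h3.pow_const _).mul ((measurable_norm.comp h2).pow_const p)).aestronglyMeasurable

lemma lintegral_Icc_inv {a b : ℝ} (ha : 0 < a) (hab : a ≤ b) :
    ∫⁻ t in Icc a b, ENNReal.ofReal t⁻¹ = ENNReal.ofReal (log (b / a)) := by
  rw [← integral_inv_of_pos ha (ha.trans_le hab), intervalIntegral.integral_of_le hab,
    ← integral_Icc_eq_integral_Ioc, ofReal_integral_eq_lintegral_ofReal]
  · refine ContinuousOn.integrableOn_Icc fun t ht => ?_
    exact (continuousAt_inv₀ (ha.trans_le ht.1).ne').continuousWithinAt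
  · filter_upwards [ae_restrict_mem measurableSet_Icc] with t ht
    exact inv_nonneg.2 (ha.le.trans ht.1)

lemma lintegral_pnorm_indicator_Icc {s : ℕ} (hs : 0 < s) {γ : ℝ} (hγ : 0 < γ) {a b : ℝ}
    (ha : 0 < a) (hab : a ≤ b) :
    ∫⁻ x in orthant s, (Icc a b).indicator (fun t => ENNReal.ofReal (t ^ (-(s : ℝ)))) (pnorm γ x) =
      ENNReal.ofReal (sphereConst s γ * log (b / a)) := by
  have hsub : Icc a b ⊆ Ioi 0 := fun t ht => ha.trans_le ht.1
  rw [lintegral_pnorm hs hγ (Measurable.indicator (by fun_prop) measurableSet_Icc),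
    ENNReal.ofReal_mul (sphereConst_pos hs hγ).le, ← lintegral_Icc_inv ha hab]
  congr 1
  rw [← inter_eq_left.2 hsub, ← setLIntegral_indicator measurableSet_Icc]
  refine setLIntegral_congr_fun measurableSet_Ioi fun t ht => ?_
  have ht' : 0 < t := ht
  by_cases h : t ∈ Icc a b
  · simp only [inter_eq_left.2 hsub, indicator_of_mem h]
    rw [← ENNReal.ofReal_mul (by positivity), ← rpow_add ht', ← rpow_neg_one]
    congr 2
    ring
  · simp only [inter_eq_left.2 hsub, indicator_of_notMem h, mul_zero]

/-- The truncated power used to show that the norm bound is sharp. -/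
noncomputable def truncPower (m : ℕ) (α σ R : ℝ) : (Fin m → ℝ) → ℝ :=
  fun x => (Icc 1 R).indicator (fun t => t ^ (σ - m)) (pnorm α x)

lemma measurable_truncPower (m : ℕ) (α σ R : ℝ) : Measurable (truncPower m α σ R) :=
  (Measurable.indicator (by fun_prop) measurableSet_Icc).comp (measurable_pnorm α)

lemma truncPower_nonneg (m : ℕ) (α σ R : ℝ) (x : Fin m → ℝ) : 0 ≤ truncPower m α σ R x :=
  indicator_nonneg (fun _ ht => rpow_nonneg (zero_le_one.trans ht.1) _) _

lemma lintegral_truncPower {m : ℕ} (hm : 0 < m) {α σ p R : ℝ} (hα : 0 < α) (hp : 0 < p)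
    (hR : 1 ≤ R) :
    ∫⁻ x in orthant m, ENNReal.ofReal
      (pnorm α x ^ (p * (m - σ) - m) * |truncPower m α σ R x| ^ p) =
      ENNReal.ofReal (sphereConst m α * log R) := by
  have h := lintegral_pnorm_indicator_Icc hm hα zero_lt_one hR
  rw [div_one] at h
  rw [← h]
  refine setLIntegral_congr_fun (measurableSet_orthant m) fun x hx => ?_
  have hx0 := pnorm_pos hm α hx
  by_cases hR : pnorm α x ∈ Icc 1 R
  · simp only [truncPower, indicator_of_mem hR]
    rw [abs_of_nonneg (by positivity), ← rpow_mul hx0.le, ← rpow_add hx0]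
    congr 2
    ring
  · simp only [truncPower, indicator_of_notMem hR]
    rw [abs_zero, zero_rpow hp.ne', mul_zero, ENNReal.ofReal_zero]

lemma integrableOn_truncPower {m : ℕ} (hm : 0 < m) {α σ p R : ℝ} (hα : 0 < α) (hp : 0 < p)
    (hR : 1 ≤ R) :
    IntegrableOn (fun x => pnorm α x ^ (p * (m - σ) - m) * |truncPower m α σ R x| ^ p)
      (orthant m) := by
  have h1 := measurable_pnorm (s := m) α
  have h2 := measurable_truncPower m α σ R
  refine ⟨by fun_prop, ?_⟩
  rw [hasFiniteIntegral_iff_ofReal, lintegral_truncPower hm hα hp hR]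
  · exact ENNReal.ofReal_lt_top
  · filter_upwards [ae_restrict_mem (measurableSet_orthant m)] with x hx
    exact mul_nonneg (rpow_nonneg (pnorm_pos hm α hx).le _) (rpow_nonneg (abs_nonneg _) _)

lemma integral_truncPower {m : ℕ} (hm : 0 < m) {α σ p R : ℝ} (hα : 0 < α) (hp : 0 < p)
    (hR : 1 ≤ R) :
    ∫ x in orthant m, pnorm α x ^ (p * (m - σ) - m) * |truncPower m α σ R x| ^ p =
      sphereConst m α * log R := by
  rw [integral_eq_lintegral_of_nonneg_ae _ (integrableOn_truncPower hm hα hp hR).1,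
    lintegral_truncPower hm hα hp hR, ENNReal.toReal_ofReal
    (mul_nonneg (sphereConst_pos hm hα).le (log_nonneg hR))]
  filter_upwards [ae_restrict_mem (measurableSet_orthant m)] with x hx
  exact mul_nonneg (rpow_nonneg (pnorm_pos hm α hx).le _) (rpow_nonneg (abs_nonneg _) _)

lemma integrableOn_cothR_mul_truncPower {m : ℕ} (hm : 0 < m) {α σ R c : ℝ} (hα : 0 < α)
    (hσ : 1 < σ) (hc : 0 < c) :
    IntegrableOn (fun x => (cothR (pnorm α x / c) - 1) * truncPower m α σ R x) (orthant m) := by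
  have h1 := measurable_cothR_sub_one_pnorm (m := m) α c
  have h2 := measurable_truncPower m α σ R
  refine ⟨(h1.mul h2).aestronglyMeasurable, ?_⟩
  rw [hasFiniteIntegral_iff_ofReal]
  · refine lt_of_le_of_lt ?_ (ENNReal.ofReal_lt_top
      (r := sphereConst m α * mellinCoth σ * c ^ σ))
    rw [← lintegral_cothR_left hm hα hσ hc]
    refine setLIntegral_mono' (measurableSet_orthant m) fun x hx => ?_
    have hx0 := pnorm_pos hm α hx
    refine ENNReal.ofReal_le_ofReal (mul_le_mul_of_nonneg_left ?_
      (cothR_sub_one_nonneg (div_pos hx0 hc)))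
    exact indicator_apply_le' (fun _ => le_rfl) fun _ => by positivity
  · filter_upwards [ae_restrict_mem (measurableSet_orthant m)] with x hx
    exact mul_nonneg (cothR_sub_one_nonneg (div_pos (pnorm_pos hm α hx) hc))
      (truncPower_nonneg m α σ R x)

/-- Lower bound for the image of a truncated power. -/
lemma le_integral_cothR_mul_truncPower {m : ℕ} (hm : 0 < m) {α σ S R c b : ℝ} (hα : 0 < α)
    (hσ : 1 < σ) (hS : 0 < S) (hcS : S ≤ c) (hcR : c * S ≤ R)
    (hb : ENNReal.ofReal b ≤
      ∫⁻ t in Icc S⁻¹ S, ENNReal.ofReal ((cothR t - 1) * t ^ (σ - 1))) :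
    sphereConst m α * b * c ^ σ ≤
      ∫ x in orthant m, (cothR (pnorm α x / c) - 1) * truncPower m α σ R x := by
  have hc : 0 < c := hS.trans_le hcS
  have hC := sphereConst_pos hm hα
  have hnn : 0 ≤ᵐ[volume.restrict (orthant m)]
      fun x => (cothR (pnorm α x / c) - 1) * truncPower m α σ R x := by
    filter_upwards [ae_restrict_mem (measurableSet_orthant m)] with x hx
    exact mul_nonneg (cothR_sub_one_nonneg (div_pos (pnorm_pos hm α hx) hc))
      (truncPower_nonneg m α σ R x)
  rw [← ENNReal.ofReal_le_ofReal_iff (integral_nonneg_of_ae hnn),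
    ofReal_integral_eq_lintegral_ofReal (integrableOn_cothR_mul_truncPower hm hα hσ hc) hnn]
  have hmeas : Measurable fun t => ENNReal.ofReal
      ((cothR (t / c) - 1) * (Icc 1 R).indicator (fun t => t ^ (σ - m)) t) := by
    have h1 := measurable_cothR
    have h2 : Measurable ((Icc 1 R).indicator fun t : ℝ => t ^ (σ - m)) :=
      Measurable.indicator (by fun_prop) measurableSet_Icc
    fun_prop
  unfold truncPower
  rw [lintegral_pnorm hm hα hmeas, mul_assoc, ENNReal.ofReal_mul hC.le,
    lintegral_Ioi_comp_mul_left hc, mul_comm b, ENNReal.ofReal_mul (rpow_nonneg hc.le _)]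
  refine mul_le_mul_right ((mul_le_mul_right hb _).trans ?_) _
  have hsub : Icc S⁻¹ S ⊆ Ioi 0 := fun t ht => (inv_pos.2 hS).trans_le ht.1
  rw [← lintegral_const_mul' _ _ ENNReal.ofReal_ne_top]
  refine le_trans ?_ (lintegral_mono_set hsub)
  refine setLIntegral_mono' measurableSet_Icc fun t ht => ?_
  have ht' : 0 < t := hsub ht
  have h0 := cothR_sub_one_nonneg ht'
  have hmem : c * t ∈ Icc 1 R := by
    constructor
    · calc (1 : ℝ) = S * S⁻¹ := (mul_inv_cancel₀ hS.ne').symm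
        _ ≤ c * t := mul_le_mul hcS ht.1 (inv_pos.2 hS).le hc.le
    · exact (mul_le_mul_of_nonneg_left ht.2 hc.le).trans hcR
  rw [indicator_of_mem hmem, ← ENNReal.ofReal_mul (by positivity),
    ← ENNReal.ofReal_mul (by positivity), ← ENNReal.ofReal_mul (by positivity),
    mul_div_cancel_left₀ _ hc.ne']
  refine ENNReal.ofReal_le_ofReal (le_of_eq ?_)
  have e : (c * t) ^ ((m : ℝ) - 1) * (c * t) ^ (σ - m) = (c * t) ^ (σ - 1) := by
    rw [← rpow_add (by positivity)]; congr 1; ring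
  calc _ = c * (cothR t - 1) * (c * t) ^ (σ - 1) := by
        rw [mul_rpow hc.le ht'.le, rpow_sub_one hc.ne']
        field_simp
    _ = _ := by rw [← e]; ring

lemma le_integral_cothR_operator_truncPower {m n : ℕ} (hm : 0 < m) (hn : 0 < n)
    {α β σ p q S b : ℝ} (hα : 0 < α) (hβ : 0 < β) (hσ : 1 < σ) (hp : 1 < p)
    (hpq : 1 / p + 1 / q = 1) (hS : 1 < S) (hb0 : 0 ≤ b)
    (hb : ENNReal.ofReal b ≤
      ∫⁻ t in Icc S⁻¹ S, ENNReal.ofReal ((cothR t - 1) * t ^ (σ - 1))) (N : ℕ) :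
    sphereConst n β * (sphereConst m α * b) ^ p * (N * log S) ≤
      ∫ y in orthant n, pnorm β y ^ (-(p * σ) - n) *
        |∫ x in orthant m, (cothR (pnorm α x / pnorm β y) - 1) *
          truncPower m α σ (S ^ (N + 2)) x| ^ p := by
  have hS0 : 0 < S := by linarith
  have hCm := sphereConst_pos hm hα
  have hCn := sphereConst_pos hn hβ
  have hR : 1 ≤ S ^ (N + 2) := one_le_pow₀ hS.le
  have hint := integrableOn_cothR_operator hm hn hα hβ hσ hp hpq
    (measurable_truncPower m α σ (S ^ (N + 2)))
    (integrableOn_truncPower hm hα (by linarith) hR)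
  have hnn : 0 ≤ᵐ[volume.restrict (orthant n)] fun y => pnorm β y ^ (-(p * σ) - n) *
        |∫ x in orthant m, (cothR (pnorm α x / pnorm β y) - 1) *
          truncPower m α σ (S ^ (N + 2)) x| ^ p := by
    filter_upwards [ae_restrict_mem (measurableSet_orthant n)] with y hy
    exact mul_nonneg (rpow_nonneg (pnorm_pos hn β hy).le _) (rpow_nonneg (abs_nonneg _) _)
  have hSN : S ≤ S ^ (N + 1) := by
    calc S = S ^ 1 := (pow_one S).symm
      _ ≤ S ^ (N + 1) := pow_le_pow_right₀ hS.le (by omega)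
  have hlog : log (S ^ (N + 1) / S) = N * log S := by
    rw [pow_succ, mul_div_cancel_right₀ _ hS0.ne', log_pow]
  rw [← ENNReal.ofReal_le_ofReal_iff (integral_nonneg_of_ae hnn),
    ofReal_integral_eq_lintegral_ofReal hint hnn, mul_right_comm, mul_comm, ← hlog,
    ENNReal.ofReal_mul (by positivity), ← lintegral_pnorm_indicator_Icc hn hβ hS0 hSN,
    ← lintegral_const_mul' _ _ ENNReal.ofReal_ne_top]
  refine setLIntegral_mono' (measurableSet_orthant n) fun y hy => ?_
  have hy0 := pnorm_pos hn β hy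
  by_cases hmem : pnorm β y ∈ Icc S (S ^ (N + 1))
  · rw [indicator_of_mem hmem, ← ENNReal.ofReal_mul (by positivity)]
    refine ENNReal.ofReal_le_ofReal ?_
    have h := le_integral_cothR_mul_truncPower (R := S ^ (N + 2)) hm hα hσ hS0 hmem.1
      (by rw [pow_succ]; exact mul_le_mul_of_nonneg_right hmem.2 hS0.le) hb
    calc _ = pnorm β y ^ (-(p * σ) - n) * (sphereConst m α * b * pnorm β y ^ σ) ^ p := by
          rw [mul_rpow (x := sphereConst m α * b) (by positivity) (by positivity),
            ← rpow_mul hy0.le, mul_left_comm,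
            ← rpow_add hy0]
          congr 2
          ring
      _ ≤ _ := by
          gcongr
          exact h.trans (le_abs_self _)
  · rw [indicator_of_notMem hmem, mul_zero]
    exact zero_le

lemma exists_lt_lintegral_Icc {σ b : ℝ} (hσ : 1 < σ) (hb0 : 0 ≤ b) (hb : b < mellinCoth σ) :
    ∃ S : ℝ, 1 < S ∧ ENNReal.ofReal b ≤
      ∫⁻ t in Icc S⁻¹ S, ENNReal.ofReal ((cothR t - 1) * t ^ (σ - 1)) := by
  have hU : ⋃ j : ℕ, Icc ((j : ℝ) + 2)⁻¹ ((j : ℝ) + 2) = Ioi 0 := by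
    ext t
    simp only [mem_iUnion, mem_Icc, mem_Ioi]
    constructor
    · rintro ⟨j, h1, _⟩
      exact lt_of_lt_of_le (by positivity) h1
    · intro ht
      obtain ⟨j, hj⟩ := exists_nat_ge (max t t⁻¹)
      refine ⟨j, ?_, ?_⟩
      · rw [inv_le_comm₀ (by positivity) ht]
        linarith [(le_max_right t t⁻¹).trans hj]
      · linarith [(le_max_left t t⁻¹).trans hj]
  have hmono : Monotone fun j : ℕ => Icc ((j : ℝ) + 2)⁻¹ ((j : ℝ) + 2) := by
    intro i j hij
    have : (i : ℝ) ≤ j := Nat.cast_le.2 hij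
    exact Icc_subset_Icc (inv_anti₀ (by positivity) (by linarith)) (by linarith)
  have h := lintegral_cothR hσ
  rw [← hU, setLIntegral_iUnion_of_directed _ hmono.directed_le] at h
  have h2 : ENNReal.ofReal b < ENNReal.ofReal (mellinCoth σ) :=
    (ENNReal.ofReal_lt_ofReal_iff (hb0.trans_lt hb)).2 hb
  rw [← h] at h2
  obtain ⟨j, hj⟩ := lt_iSup_iff.1 h2
  exact ⟨(j : ℝ) + 2, by linarith [(Nat.cast_nonneg j : (0 : ℝ) ≤ j)], hj.le⟩

/-- Sharpness of the norm bound. -/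
lemma exists_lt_cothR_operator {m n : ℕ} (hm : 0 < m) (hn : 0 < n)
    {α β σ p q : ℝ} (hα : 0 < α) (hβ : 0 < β) (hσ : 1 < σ) (hp : 1 < p)
    (hpq : 1 / p + 1 / q = 1) {w : ℝ} (hw : w < cothNorm m n α β σ p q) :
    ∃ R : ℝ, 1 < R ∧ w * (∫ x in orthant m, pnorm α x ^ (p * (m - σ) - m) *
        |truncPower m α σ R x| ^ p) ^ (1 / p) <
      (∫ y in orthant n, pnorm β y ^ (-(p * σ) - n) *
        |∫ x in orthant m, (cothR (pnorm α x / pnorm β y) - 1) *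
          truncPower m α σ R x| ^ p) ^ (1 / p) := by
  have hp0 : 0 < p := by linarith
  have hM := mellinCoth_pos hσ
  have hCm := sphereConst_pos hm hα
  have hCn := sphereConst_pos hn hβ
  set A := sphereConst n β ^ (1 / p) * sphereConst m α ^ (1 / q) with hA
  have hA0 : 0 < A := by positivity
  have hw' : w / A < mellinCoth σ := by
    rw [div_lt_iff₀ hA0, mul_comm]; exact hw
  obtain ⟨b, hb1, hb2⟩ := exists_between (max_lt hw' hM)
  have hb0 : 0 < b := (le_max_right _ _).trans_lt hb1
  have hwb : w < A * b := by
    rw [mul_comm, ← div_lt_iff₀ hA0]; exact (le_max_left _ _).trans_lt hb1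
  obtain ⟨S, hS, hbS⟩ := exists_lt_lintegral_Icc hσ hb0.le hb2
  have hlog : 0 < log S := log_pos hS
  have hlim : Filter.Tendsto (fun N : ℕ => A * b * ((N : ℝ) / (N + 2)) ^ (1 / p)) Filter.atTop
      (nhds (A * b)) := by
    have h1 := (tendsto_natCast_div_add_atTop (𝕜 := ℝ) 2).rpow_const
      (p := 1 / p) (Or.inl one_ne_zero)
    simpa using h1.const_mul (A * b)
  obtain ⟨N, hN⟩ := (hlim.eventually (lt_mem_nhds hwb)).exists
  refine ⟨S ^ (N + 2), one_lt_pow₀ hS (by omega), ?_⟩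
  rw [integral_truncPower hm hα hp0 (one_le_pow₀ hS.le), log_pow]
  have hX : 0 < (sphereConst m α * (((N + 2 : ℕ) : ℝ) * log S)) ^ (1 / p) := by positivity
  refine (mul_lt_mul_of_pos_right hN hX).trans_le ?_
  refine le_trans (le_of_eq ?_) (rpow_le_rpow (by positivity)
    (le_integral_cothR_operator_truncPower hm hn hα hβ hσ hp hpq hS hb0.le hbS N) (by positivity))
  have hq : sphereConst m α ^ (1 / q) * sphereConst m α ^ (1 / p) = sphereConst m α := by
    rw [← rpow_add hCm, add_comm, hpq, rpow_one]
  have hN2 : (0 : ℝ) < (N : ℝ) + 2 := by positivity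
  have e1 : ((sphereConst m α * b) ^ p) ^ (1 / p) = sphereConst m α * b := by
    rw [← rpow_mul (by positivity), mul_one_div_cancel hp0.ne', rpow_one]
  have e2 : ((N : ℝ) / (N + 2)) ^ (1 / p) * (((N : ℝ) + 2) * log S) ^ (1 / p) =
      (N * log S) ^ (1 / p) := by
    rw [← mul_rpow (by positivity) (by positivity)]
    congr 1
    field_simp
  push_cast
  rw [mul_rpow (x := sphereConst m α) (by positivity) (by positivity),
    mul_rpow (x := sphereConst n β * _) (by positivity) (by positivity),
    mul_rpow (x := sphereConst n β) (by positivity) (by positivity), e1, ← e2, hA]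
  calc _ = sphereConst n β ^ (1 / p) * ((sphereConst m α ^ (1 / q) * sphereConst m α ^ (1 / p)) * b)
        * (((N : ℝ) / (N + 2)) ^ (1 / p) * (((N : ℝ) + 2) * log S) ^ (1 / p)) := by ring
    _ = _ := by rw [hq]

theorem stmt_17 (m n : ℕ) (hm : 0 < m) (hn : 0 < n) (α β σ p q : ℝ)
    (hα : 0 < α) (hβ : 0 < β) (hσ : 1 < σ) (hp : 1 < p) (hpq : 1 / p + 1 / q = 1)
    (Φ : (Fin m → ℝ) → ℝ) (hΦ : Φ = fun x => pnorm α x ^ (p * (m - σ) - m))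
    (Ψ : (Fin n → ℝ) → ℝ) (hΨ : Ψ = fun y => pnorm β y ^ (q * (n + σ) - n))
    (T : ((Fin m → ℝ) → ℝ) → ((Fin n → ℝ) → ℝ))
    (hT : ∀ f y, T f y =
      ∫ x in {x : Fin m → ℝ | ∀ i, 0 < x i}, (cothR (pnorm α x / pnorm β y) - 1) * f x)
    (K : ℝ)
    (hK : K = (Real.Gamma (1 / β) ^ n / (β ^ (n - 1) * Real.Gamma (n / β))) ^ (1 / p) *
      (Real.Gamma (1 / α) ^ m / (α ^ (m - 1) * Real.Gamma (m / α))) ^ (1 / q) *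
      (Real.Gamma σ / 2 ^ (σ - 1)) * zetaR σ) :
    (∀ f : (Fin m → ℝ) → ℝ, Measurable f →
        IntegrableOn (fun x => Φ x * |f x| ^ p) {x : Fin m → ℝ | ∀ i, 0 < x i} volume →
        wnorm p (fun y => Ψ y ^ (1 - p)) (T f) ≤ K * wnorm p Φ f) ∧
    sSup {r : ℝ | ∃ f : (Fin m → ℝ) → ℝ, Measurable f ∧
        IntegrableOn (fun x => Φ x * |f x| ^ p) {x : Fin m → ℝ | ∀ i, 0 < x i} volume ∧
        0 < wnorm p Φ f ∧ r = wnorm p (fun y => Ψ y ^ (1 - p)) (T f) / wnorm p Φ f} = K := by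
  have hp0 : 0 < p := by linarith
  have hq0 : q ≠ 0 := by
    rintro rfl
    rw [div_zero, add_zero, div_eq_one_iff_eq hp0.ne'] at hpq
    linarith
  have hqp : q * (1 - p) = -p := by
    field_simp at hpq
    linear_combination hpq
  have hKN : K = cothNorm m n α β σ p q := by
    rw [hK, cothNorm, sphereConst, sphereConst, mellinCoth]
    ring
  have hK0 : 0 < K := hKN ▸ cothNorm_pos hm hn p q hα hβ hσ
  have hΦn : ∀ f, wnorm p Φ f =
      (∫ x in orthant m, pnorm α x ^ (p * (m - σ) - m) * |f x| ^ p) ^ (1 / p) := by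
    intro f
    rw [hΦ]
    rfl
  have hΨn : ∀ f, wnorm p (fun y => Ψ y ^ (1 - p)) (T f) =
      (∫ y in orthant n, pnorm β y ^ (-(p * σ) - n) *
        |∫ x in orthant m, (cothR (pnorm α x / pnorm β y) - 1) * f x| ^ p) ^ (1 / p) := by
    intro f
    unfold wnorm
    congr 1
    refine setIntegral_congr_fun (measurableSet_orthant n) fun y hy => ?_
    simp only [hΨ, hT]
    rw [← rpow_mul (pnorm_pos hn β hy).le]
    congr 2
    linear_combination (n + σ) * hqp
  have hbound : ∀ f : (Fin m → ℝ) → ℝ, Measurable f →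
      IntegrableOn (fun x => Φ x * |f x| ^ p) {x : Fin m → ℝ | ∀ i, 0 < x i} volume →
      wnorm p (fun y => Ψ y ^ (1 - p)) (T f) ≤ K * wnorm p Φ f := by
    intro f hf hfi
    rw [hΦ] at hfi
    rw [hΦn, hΨn]
    have hI := integral_pnorm_mul_rpow_nonneg hm α (p * (m - σ) - m) p f
    have h := integral_cothR_operator_le hm hn hα hβ hσ hp hpq hf hfi
    rw [← hKN] at h
    refine (rpow_le_rpow (integral_pnorm_mul_rpow_nonneg hn β _ p _) h
      (one_div_pos.2 hp0).le).trans_eq ?_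
    rw [mul_rpow (by positivity) hI, ← rpow_mul hK0.le, mul_one_div_cancel hp0.ne', rpow_one]
  have hsharp : ∀ w < K, ∃ r ∈ {r : ℝ | ∃ f : (Fin m → ℝ) → ℝ, Measurable f ∧
        IntegrableOn (fun x => Φ x * |f x| ^ p) {x : Fin m → ℝ | ∀ i, 0 < x i} volume ∧
        0 < wnorm p Φ f ∧ r = wnorm p (fun y => Ψ y ^ (1 - p)) (T f) / wnorm p Φ f}, w < r := by
    intro w hw
    rw [hKN] at hw
    obtain ⟨R, hR, h⟩ := exists_lt_cothR_operator hm hn hα hβ hσ hp hpq hw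
    have hpos : 0 < wnorm p Φ (truncPower m α σ R) := by
      rw [hΦn, integral_truncPower hm hα hp0 hR.le]
      exact rpow_pos_of_pos (mul_pos (sphereConst_pos hm hα) (log_pos hR)) _
    refine ⟨_, ⟨truncPower m α σ R, measurable_truncPower m α σ R, ?_, hpos, rfl⟩, ?_⟩
    · rw [hΦ]
      exact integrableOn_truncPower hm hα hp0 hR.le
    · rwa [lt_div_iff₀ hpos, hΦn, hΨn]
  refine ⟨hbound, csSup_eq_of_forall_le_of_forall_lt_exists_gt ?_ ?_ hsharp⟩
  · obtain ⟨r, hr, -⟩ := hsharp (K - 1) (by linarith)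
    exact ⟨r, hr⟩
  · rintro r ⟨f, hf, hfi, hpos, rfl⟩
    rw [div_le_iff₀ hpos]
    exact hbound f hf hfi
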